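/- Let p ≥ 2 be an integer, define v : [0, 2π] → ℝ by v(t) = (1/p − 1/2)((π − t)/π)³ + (1/p)·(t − π)/π + 1/2, and define w(t) = 2π v(t)^p / (v(t)^p + v(2π − t)^p). Then v(t) ≥ 0 on [0, 2π] with v(t)^p + v(2π − t)^p > 0 for all t ∈ (0, 2π), and w is a strictly increasing, infinitely differentiable bijection of [0, 2π] onto [0, 2π] with w(0) = 0 and w(2π) = 2π; moreover w has a zero of order p at the endpoints, i.e. the derivatives w^{(k)}(0) = 0 and (w − 2π)^{(k)}(2π) = 0 for k = 1, …, p − 1. -/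

import Mathlib

open Real Set

/-- If `g` vanishes at `a`, then `g ^ n * h` has a zero of order at least `n` at `a`. -/
theorem iteratedDerivWithin_pow_mul_eq_zero {s : Set ℝ} (hs : UniqueDiffOn ℝ s) {a : ℝ}
    (ha : a ∈ s) {g : ℝ → ℝ} (hg : ContDiffOn ℝ (⊤ : ℕ∞) g s) (hga : g a = 0) (k : ℕ) :
    ∀ (n : ℕ) (h : ℝ → ℝ), k < n → ContDiffOn ℝ (⊤ : ℕ∞) h s →
      iteratedDerivWithin k (fun x => g x ^ n * h x) s a = 0 := by
  induction k with
  | zero =>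
    intro n h hn _
    simp [hga, show n ≠ 0 by omega]
  | succ k ih =>
    intro n h hn hh
    obtain ⟨m, rfl⟩ : ∃ m, n = m + 1 := ⟨n - 1, by omega⟩
    have hg' : ContDiffOn ℝ (⊤ : ℕ∞) (derivWithin g s) s := hg.derivWithin hs (by simp)
    have hh' : ContDiffOn ℝ (⊤ : ℕ∞) (derivWithin h s) s := hh.derivWithin hs (by simp)
    rw [iteratedDerivWithin_succ']
    have key : EqOn (derivWithin (fun x => g x ^ (m + 1) * h x) s)
        (fun x => g x ^ m * ((m + 1) * derivWithin g s x * h x + g x * derivWithin h s x)) s := by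
      intro x hx
      have h1 := (hg.differentiableOn (by simp) x hx).hasDerivWithinAt
      have h2 := (hh.differentiableOn (by simp) x hx).hasDerivWithinAt
      have h3 := ((h1.fun_pow (m + 1)).fun_mul h2).derivWithin (hs x hx)
      rw [h3]
      push_cast
      ring
    rw [iteratedDerivWithin_congr key ha]
    exact ih m _ (by omega) (((contDiffOn_const.mul hg').mul hh).add (hg.mul hh'))

theorem pow_add_one_sub_pow_pos {x : ℝ} (h0 : 0 ≤ x) (h1 : x ≤ 1) (p : ℕ) :
    0 < x ^ p + (1 - x) ^ p := by
  rcases h0.eq_or_lt with rfl | h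
  · have : (0 : ℝ) ≤ 0 ^ p := by positivity
    simp only [sub_zero, one_pow]
    linarith
  · have : 0 ≤ 1 - x := by linarith
    positivity

theorem strictMonoOn_pow_div_pow_add_one_sub_pow {p : ℕ} (hp : p ≠ 0) :
    StrictMonoOn (fun x : ℝ => x ^ p / (x ^ p + (1 - x) ^ p)) (Icc 0 1) := by
  intro x hx y hy hxy
  simp only
  rw [div_lt_div_iff₀ (pow_add_one_sub_pow_pos hx.1 hx.2 p) (pow_add_one_sub_pow_pos hy.1 hy.2 p)]
  have h : (x * (1 - y)) ^ p < (y * (1 - x)) ^ p :=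
    pow_lt_pow_left₀ (by linarith) (mul_nonneg hx.1 (by linarith [hy.2])) hp
  rw [mul_pow, mul_pow] at h
  linarith

theorem strictMono_kress_cubic {a : ℝ} (h0 : 0 < a) (h1 : a ≤ 1 / 2) :
    StrictMono fun t : ℝ => (a - 1 / 2) * ((Real.pi - t) / Real.pi) ^ 3 +
      a * ((t - Real.pi) / Real.pi) + 1 / 2 := by
  intro x y hxy
  have hs : (x - Real.pi) / Real.pi < (y - Real.pi) / Real.pi := by
    gcongr
  have hneg : ∀ t : ℝ, (Real.pi - t) / Real.pi = -((t - Real.pi) / Real.pi) := fun t => by ring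
  simp only [hneg]
  have h3 := (Odd.strictMono_pow (R := ℝ) (n := 3) (by decide)).monotone hs.le
  nlinarith

/-- The Kress grading function `w` built from the cubic polynomial `v`:
`v` is nonnegative on `[0, 2π]`, the denominator of `w` is positive on `(0, 2π)`,
and `w` is a strictly increasing, infinitely differentiable bijection of `[0, 2π]`
onto itself with `w(0) = 0`, `w(2π) = 2π` that has a zero of order `p` at both
endpoints. -/
theorem kress_grading_function (p : ℕ) (hp : 2 ≤ p) (v w : ℝ → ℝ)
    (hv : ∀ t, v t = (1 / (p : ℝ) - 1 / 2) * ((Real.pi - t) / Real.pi) ^ 3 +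
      (1 / (p : ℝ)) * ((t - Real.pi) / Real.pi) + 1 / 2)
    (hw : ∀ t, w t = 2 * Real.pi * (v t) ^ p / ((v t) ^ p + (v (2 * Real.pi - t)) ^ p)) :
    (∀ t ∈ Icc 0 (2 * Real.pi), 0 ≤ v t) ∧
    (∀ t ∈ Ioo 0 (2 * Real.pi), 0 < (v t) ^ p + (v (2 * Real.pi - t)) ^ p) ∧
    StrictMonoOn w (Icc 0 (2 * Real.pi)) ∧
    ContDiffOn ℝ (⊤ : ℕ∞) w (Icc 0 (2 * Real.pi)) ∧
    Set.BijOn w (Icc 0 (2 * Real.pi)) (Icc 0 (2 * Real.pi)) ∧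
    w 0 = 0 ∧ w (2 * Real.pi) = 2 * Real.pi ∧
    (∀ k : ℕ, 1 ≤ k → k ≤ p - 1 →
      iteratedDerivWithin k w (Icc 0 (2 * Real.pi)) 0 = 0 ∧
      iteratedDerivWithin k (fun t => w t - 2 * Real.pi) (Icc 0 (2 * Real.pi))
        (2 * Real.pi) = 0) := by
  have hpi := Real.pi_pos
  have hp0 : p ≠ 0 := by omega
  have h2pi : (0 : ℝ) < 2 * Real.pi := by positivity
  have hmono : StrictMono v := by
    rw [funext hv]
    have hp2 : (2 : ℝ) ≤ p := by exact_mod_cast hp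
    exact strictMono_kress_cubic (by positivity) (one_div_le_one_div_of_le two_pos hp2)
  have hrefl : ∀ t, v (2 * Real.pi - t) = 1 - v t := fun t => by
    rw [hv, hv]
    ring
  have hv0 : v 0 = 0 := by
    rw [hv]
    field_simp
    ring
  have hv1 : v (2 * Real.pi) = 1 := by
    have := hrefl 0
    rwa [sub_zero, hv0, sub_zero] at this
  have hmaps : MapsTo v (Icc 0 (2 * Real.pi)) (Icc 0 1) := fun t ht =>
    ⟨hv0 ▸ hmono.monotone ht.1, hv1 ▸ hmono.monotone ht.2⟩
  have hw' : ∀ t, w t = 2 * Real.pi * (v t ^ p / (v t ^ p + (1 - v t) ^ p)) := fun t => by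
    rw [hw, hrefl, mul_div_assoc]
  have hden : ∀ t ∈ Icc 0 (2 * Real.pi), 0 < v t ^ p + (1 - v t) ^ p := fun t ht =>
    pow_add_one_sub_pow_pos (hmaps ht).1 (hmaps ht).2 p
  have hvs : ContDiff ℝ (⊤ : ℕ∞) v := by
    rw [funext hv]
    fun_prop
  have hqs : ContDiffOn ℝ (⊤ : ℕ∞) (fun t => 2 * Real.pi / (v t ^ p + (1 - v t) ^ p))
      (Icc 0 (2 * Real.pi)) :=
    contDiffOn_const.div (ContDiff.contDiffOn (by fun_prop)) fun t ht => (hden t ht).ne'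
  have hwq : w = fun t => v t ^ p * (2 * Real.pi / (v t ^ p + (1 - v t) ^ p)) := by
    funext t
    rw [hw']
    ring
  have hws : ContDiffOn ℝ (⊤ : ℕ∞) w (Icc 0 (2 * Real.pi)) := by
    rw [hwq]
    exact (hvs.pow p).contDiffOn.mul hqs
  have hwmono : StrictMonoOn w (Icc 0 (2 * Real.pi)) := fun x hx y hy hxy => by
    rw [hw', hw']
    exact mul_lt_mul_of_pos_left (strictMonoOn_pow_div_pow_add_one_sub_pow hp0 (hmaps hx)
      (hmaps hy) (hmono hxy)) h2pi
  have hw0 : w 0 = 0 := by simp [hw', hv0, hp0]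
  have hw1 : w (2 * Real.pi) = 2 * Real.pi := by simp [hw', hv1, hp0]
  have hl : (0 : ℝ) ∈ Icc 0 (2 * Real.pi) := left_mem_Icc.2 h2pi.le
  have hr : 2 * Real.pi ∈ Icc 0 (2 * Real.pi) := right_mem_Icc.2 h2pi.le
  refine ⟨fun t ht => (hmaps ht).1, fun t ht => ?_, hwmono, hws, ⟨fun t ht => ?_,
    hwmono.injOn, ?_⟩, hw0, hw1, fun k _ hk => ⟨?_, ?_⟩⟩
  · rw [hrefl]
    exact hden t (Ioo_subset_Icc_self ht)
  · exact ⟨hw0 ▸ hwmono.monotoneOn hl ht ht.1, (hwmono.monotoneOn ht hr ht.2).trans_eq hw1⟩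
  · have := intermediate_value_Icc h2pi.le hws.continuousOn
    rwa [hw0, hw1] at this
  · rw [hwq]
    exact iteratedDerivWithin_pow_mul_eq_zero (uniqueDiffOn_Icc h2pi) hl hvs.contDiffOn hv0 k p _
      (by omega) hqs
  · have key : EqOn (fun t => w t - 2 * Real.pi)
        (fun t => (1 - v t) ^ p * -(2 * Real.pi / (v t ^ p + (1 - v t) ^ p)))
        (Icc 0 (2 * Real.pi)) := fun t ht => by
      have := (hden t ht).ne'
      simp only [hw']
      field_simp
      ring
    rw [iteratedDerivWithin_congr key hr]
    exact iteratedDerivWithin_pow_mul_eq_zero (uniqueDiffOn_Icc h2pi) hr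
      (contDiff_const.sub hvs).contDiffOn (by simp [hv1]) k p _ (by omega) hqs.neg
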